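/- There is an absolute constant c > 0 such that for all finite sets A, B ⊆ ℝ with |A| ≥ 2 and |B| ≥ 2, one has |(A+B)·(A−B)| ≥ c·|A||B|/(log|A| + log|B|). -/

import Mathlib

open Pointwise

section

open Finset

/-- The points of `A × A` on the line `x - l.1 * y = l.2`. -/
noncomputable def linePoints (A : Finset ℝ) (l : ℝ × ℝ) : Finset (ℝ × ℝ) :=
  (A ×ˢ A).filter fun p => p.1 - l.1 * p.2 = l.2

/-- The number of elements of `A` below `a`, divided (rounding down) by `q`: the index of the
block containing `a` when `A` is cut into blocks of `q` consecutive elements. -/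
noncomputable def blockIndex (A : Finset ℝ) (q : ℕ) (a : ℝ) : ℕ :=
  #{b ∈ A | b < a} / q

theorem mem_linePoints {A : Finset ℝ} {l p : ℝ × ℝ} :
    p ∈ linePoints A l ↔ (p.1 ∈ A ∧ p.2 ∈ A) ∧ p.1 - l.1 * p.2 = l.2 := by
  simp [linePoints]

theorem blockIndex_mono (A : Finset ℝ) (q : ℕ) : Monotone (blockIndex A q) := by
  intro a b hab
  refine Nat.div_le_div_right (card_le_card fun x hx => ?_)
  simp only [mem_filter] at hx ⊢
  exact ⟨hx.1, hx.2.trans_le hab⟩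

theorem card_filter_lt_lt_card {A : Finset ℝ} {a : ℝ} (ha : a ∈ A) : #{b ∈ A | b < a} < #A :=
  card_lt_card (filter_ssubset.2 ⟨a, ha, lt_irrefl a⟩)

theorem blockIndex_le {A : Finset ℝ} (q : ℕ) {a : ℝ} (ha : a ∈ A) :
    blockIndex A q a ≤ (#A - 1) / q :=
  Nat.div_le_div_right (Nat.le_sub_one_of_lt (card_filter_lt_lt_card ha))

theorem injOn_card_filter_lt (A : Finset ℝ) : Set.InjOn (fun a => #{b ∈ A | b < a}) A := by
  have key : ∀ a ∈ A, ∀ a' : ℝ, a < a' → #{b ∈ A | b < a} < #{b ∈ A | b < a'} := by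
    intro a ha a' h
    refine card_lt_card (ssubset_iff_of_subset (fun x hx => ?_) |>.2 ⟨a, ?_, ?_⟩)
    · simp only [mem_filter] at hx ⊢
      exact ⟨hx.1, hx.2.trans h⟩
    · simp [ha, h]
    · simp
  intro a ha a' ha' h
  rcases lt_trichotomy a a' with h' | h' | h'
  · exact absurd h (key a ha a' h').ne
  · exact h'
  · exact absurd h (key a' ha' a h').ne'

theorem card_block_le (A : Finset ℝ) {q : ℕ} (hq : 0 < q) (j : ℕ) :
    #{a ∈ A | blockIndex A q a = j} ≤ q := by
  calc #{a ∈ A | blockIndex A q a = j} ≤ #(Ico (j * q) (j * q + q)) := by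
        refine card_le_card_of_injOn (fun a => #{b ∈ A | b < a}) (fun a ha => ?_)
          ((injOn_card_filter_lt A).mono fun a ha => ?_)
        · have h := (Nat.div_eq_iff hq).1 (mem_filter.1 (mem_coe.1 ha)).2
          simp only [coe_Ico, Set.mem_Ico]
          omega
        · exact mem_coe.2 (mem_filter.1 (mem_coe.1 ha)).1
    _ = q := by simp

theorem card_filter_product_eq_sum {α β γ : Type*} [DecidableEq γ] (S : Finset α) (T : Finset β)
    (f : α → γ) (g : β → γ) (R : Finset γ) (hf : ∀ a ∈ S, f a ∈ R) :
    #{z ∈ S ×ˢ T | f z.1 = g z.2} = ∑ r ∈ R, #{a ∈ S | f a = r} * #{b ∈ T | g b = r} := by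
  rw [card_eq_sum_card_fiberwise (f := fun z : α × β => f z.1) (t := R)]
  · refine sum_congr rfl fun r _ => ?_
    rw [← card_product]
    congr 1
    ext z
    simp only [mem_filter, mem_product]
    grind
  · intro z hz
    exact hf _ (mem_product.1 (mem_filter.1 (mem_coe.1 hz)).1).1

theorem card_filter_blockIndex_eq_le (A : Finset ℝ) {q : ℕ} (hq : 0 < q) :
    #{z ∈ A ×ˢ A | blockIndex A q z.1 = blockIndex A q z.2} ≤ #A * q := by
  rw [card_filter_product_eq_sum A A _ _ (A.image (blockIndex A q))
    fun a ha => mem_image_of_mem _ ha]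
  calc _ ≤ ∑ r ∈ A.image (blockIndex A q), #{a ∈ A | blockIndex A q a = r} * q :=
        sum_le_sum fun r _ => Nat.mul_le_mul_left _ (card_block_le A hq r)
    _ = #A * q := by rw [← sum_mul, ← card_eq_sum_card_image]

theorem card_le_card_filter_offDiag_add {α : Type*} [DecidableEq α] (F : Finset α) (f : α → ℕ)
    (K : ℕ) (hf : ∀ p ∈ F, f p < K) :
    #F ≤ #{z ∈ F.offDiag | f z.1 = f z.2} + K := by
  have h1 : #{z ∈ F ×ˢ F | f z.1 = f z.2} = #{z ∈ F.offDiag | f z.1 = f z.2} + #F := by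
    rw [← diag_union_offDiag, filter_union, card_union_of_disjoint
      (disjoint_filter_filter (disjoint_diag_offDiag F)), add_comm]
    congr 1
    rw [filter_true_of_mem, diag_card]
    intro z hz
    rw [(mem_diag.1 hz).2]
  have h2 := card_filter_product_eq_sum F F f f (range K) fun p hp => mem_range.2 (hf p hp)
  have h3 : #F = ∑ r ∈ range K, #{a ∈ F | f a = r} :=
    card_eq_sum_card_fiberwise fun p hp => mem_coe.2 (mem_range.2 (hf p hp))
  have h4 : 2 * #F ≤ #{z ∈ F ×ˢ F | f z.1 = f z.2} + K := by
    rw [h2, h3, mul_sum]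
    calc _ ≤ ∑ r ∈ range K, (#{a ∈ F | f a = r} * #{a ∈ F | f a = r} + 1) := by
          refine sum_le_sum fun r _ => ?_
          zify
          nlinarith [sq_nonneg ((#{a ∈ F | f a = r} : ℤ) - 1)]
      _ = _ := by simp [sum_add_distrib]
  omega

/-- A non-degenerate line meets at most `2 * M + 1` of the cells of a grid. -/
theorem card_linePoints_le (A : Finset ℝ) (q : ℕ) {l : ℝ × ℝ} (hl : l.1 ≠ 0) :
    #(linePoints A l) ≤ #{z ∈ (linePoints A l).offDiag |
      blockIndex A q z.1.1 = blockIndex A q z.2.1 ∧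
      blockIndex A q z.1.2 = blockIndex A q z.2.2} + (2 * ((#A - 1) / q) + 1) := by
  set M := (#A - 1) / q with hM
  have hmono := blockIndex_mono A q
  have main : ∃ f : ℝ × ℝ → ℕ, (∀ p ∈ linePoints A l, f p < 2 * M + 1) ∧
      ∀ p ∈ linePoints A l, ∀ p' ∈ linePoints A l, f p = f p' →
        blockIndex A q p.1 = blockIndex A q p'.1 ∧ blockIndex A q p.2 = blockIndex A q p'.2 := by
    rcases lt_or_gt_of_ne hl with h0 | h0
    · refine ⟨fun p => blockIndex A q p.1 + (M - blockIndex A q p.2), fun p hp => ?_,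
        fun p hp p' hp' h => ?_⟩
      · have h1 := blockIndex_le q (mem_linePoints.1 hp).1.1
        dsimp only
        omega
      · rw [mem_linePoints] at hp hp'
        have h1 := blockIndex_le q hp.1.2
        have h2 := blockIndex_le q hp'.1.2
        dsimp only at h
        rcases le_total p.2 p'.2 with h3 | h3
        · have h4 : p'.1 ≤ p.1 := by nlinarith
          have := hmono h3
          have := hmono h4
          omega
        · have h4 : p.1 ≤ p'.1 := by nlinarith
          have := hmono h3
          have := hmono h4
          omega
    · refine ⟨fun p => blockIndex A q p.1 + blockIndex A q p.2, fun p hp => ?_,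
        fun p hp p' hp' h => ?_⟩
      · have h1 := blockIndex_le q (mem_linePoints.1 hp).1.1
        have h2 := blockIndex_le q (mem_linePoints.1 hp).1.2
        dsimp only
        omega
      · rw [mem_linePoints] at hp hp'
        dsimp only at h
        rcases le_total p.2 p'.2 with h3 | h3
        · have h4 : p.1 ≤ p'.1 := by nlinarith
          have := hmono h3
          have := hmono h4
          omega
        · have h4 : p'.1 ≤ p.1 := by nlinarith
          have := hmono h3
          have := hmono h4
          omega
  obtain ⟨f, hf, hcell⟩ := main
  refine (card_le_card_filter_offDiag_add _ f _ hf).trans (Nat.add_le_add_right ?_ _)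
  refine card_le_card fun z hz => ?_
  simp only [mem_filter, mem_offDiag] at hz ⊢
  exact ⟨hz.1, hcell _ hz.1.1 _ hz.1.2.1 hz.2⟩

theorem eq_of_mem_linePoints {A : Finset ℝ} {l l' p p' : ℝ × ℝ} (hne : p ≠ p')
    (hp : p ∈ linePoints A l) (hp' : p' ∈ linePoints A l) (h : p ∈ linePoints A l')
    (h' : p' ∈ linePoints A l') : l = l' := by
  rw [mem_linePoints] at hp hp' h h'
  have h2 : p.2 - p'.2 ≠ 0 := by
    intro h0
    have h0 := sub_eq_zero.1 h0
    refine hne (Prod.ext ?_ h0)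
    have e1 := hp.2
    have e2 := hp'.2
    rw [h0] at e1
    linarith
  have h1 : l.1 = l'.1 := by
    apply mul_right_cancel₀ h2
    linarith [hp.2, hp'.2, h.2, h'.2]
  refine Prod.ext h1 ?_
  rw [← hp.2, ← h.2, h1]

theorem sum_card_linePoints_cells_le (A : Finset ℝ) {q : ℕ} (hq : 0 < q)
    (Λ : Finset (ℝ × ℝ)) :
    ∑ l ∈ Λ, #{z ∈ (linePoints A l).offDiag |
      blockIndex A q z.1.1 = blockIndex A q z.2.1 ∧
      blockIndex A q z.1.2 = blockIndex A q z.2.2} ≤ (#A * q) ^ 2 := by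
  rw [← card_biUnion]
  · set T := {z ∈ A ×ˢ A | blockIndex A q z.1 = blockIndex A q z.2} with hT
    calc _ ≤ #(T ×ˢ T) := by
          refine card_le_card_of_injOn
            (fun z : (ℝ × ℝ) × (ℝ × ℝ) => ((z.1.1, z.2.1), (z.1.2, z.2.2))) ?_ ?_
          · intro z hz
            simp only [coe_biUnion, Set.mem_iUnion, mem_coe, mem_filter, mem_offDiag,
              mem_linePoints] at hz
            obtain ⟨l, _, hz⟩ := hz
            simp only [hT, mem_coe, mem_product, mem_filter]
            tauto
          · intro z _ z' _ h
            simp only [Prod.mk.injEq] at h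
            ext <;> simp [h]
      _ ≤ (#A * q) ^ 2 := by
          rw [card_product, sq]
          exact Nat.mul_le_mul (card_filter_blockIndex_eq_le A hq)
            (card_filter_blockIndex_eq_le A hq)
  · intro l _ l' _ hll
    refine disjoint_left.2 fun z hz hw => hll ?_
    simp only [mem_filter, mem_offDiag] at hz hw
    exact eq_of_mem_linePoints hz.1.2.2 hz.1.1 hz.1.2.1 hw.1.1 hw.1.2.1

/-- The Szemerédi–Trotter bound for rich lines in a Cartesian product `A × A`. -/
theorem card_rich_lines_le (A : Finset ℝ) {k : ℕ} (hk : 2 ≤ k) (Λ : Finset (ℝ × ℝ))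
    (h0 : ∀ l ∈ Λ, l.1 ≠ 0) (hΛ : ∀ l ∈ Λ, k ≤ #(linePoints A l)) (hkA : k ≤ #A) :
    (#Λ : ℝ) ≤ 100 * (#A : ℝ) ^ 4 / k ^ 3 := by
  obtain ⟨q, hq⟩ : ∃ q, q = ⌈(4 * #A : ℝ) / k⌉₊ := ⟨_, rfl⟩
  have hk0 : (0 : ℝ) < k := by positivity
  have hA0 : (0 : ℝ) < #A := by exact_mod_cast (by omega : 0 < #A)
  have hq0 : 0 < q := by rw [hq]; exact Nat.ceil_pos.2 (by positivity)
  have hq1 : 4 * #A ≤ q * k := by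
    have := Nat.le_ceil ((4 * #A : ℝ) / k)
    rw [← hq, div_le_iff₀ hk0] at this
    exact_mod_cast this
  have hq2 : (q : ℝ) ≤ 5 * #A / k := by
    have h1 := Nat.ceil_lt_add_one (a := (4 * #A : ℝ) / k) (by positivity)
    rw [← hq] at h1
    have h2 : (1 : ℝ) ≤ #A / k := by
      rw [le_div_iff₀ hk0, one_mul]
      exact_mod_cast hkA
    have h3 : (5 * #A : ℝ) / k = 4 * #A / k + #A / k := by ring
    linarith
  have hM : 4 * ((#A - 1) / q) < k := by
    have h1 := Nat.div_mul_le_self (#A - 1) q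
    by_contra! h
    have h2 : q * k ≤ q * (4 * ((#A - 1) / q)) := Nat.mul_le_mul_left _ h
    have h3 : q * (4 * ((#A - 1) / q)) = 4 * ((#A - 1) / q * q) := by ring
    omega
  have h1 : #Λ * k ≤ 4 * (#A * q) ^ 2 := by
    refine le_trans ?_ (Nat.mul_le_mul_left 4 (sum_card_linePoints_cells_le A hq0 Λ))
    rw [← smul_eq_mul, ← sum_const, mul_sum]
    refine sum_le_sum fun l hl => ?_
    have h2 := card_linePoints_le A q (h0 l hl)
    have h3 := hΛ l hl
    omega
  have h2 : (#Λ : ℝ) * k ≤ 4 * (#A * q) ^ 2 := by exact_mod_cast h1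
  have h3 : 4 * ((#A : ℝ) * q) ^ 2 ≤ 4 * (#A * (5 * #A / k)) ^ 2 := by gcongr
  have h4 : 4 * (#A * (5 * #A / k)) ^ 2 = 100 * (#A : ℝ) ^ 4 / k ^ 3 * k := by
    field_simp
    ring
  exact le_of_mul_le_mul_right (by linarith) hk0

theorem card_linePoints_le_card (A : Finset ℝ) (l : ℝ × ℝ) : #(linePoints A l) ≤ #A := by
  refine card_le_card_of_injOn Prod.snd (fun p hp => (mem_linePoints.1 hp).1.2) ?_
  intro p hp p' hp' h
  have e := (mem_linePoints.1 hp).2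
  have e' := (mem_linePoints.1 hp').2
  refine Prod.ext ?_ h
  rw [h] at e
  linarith

theorem sum_Icc_two_inv_le_log {n : ℕ} (hn : 1 ≤ n) :
    ∑ k ∈ Icc 2 n, (1 / k : ℝ) ≤ Real.log n := by
  have h := harmonic_le_one_add_log n
  rw [harmonic_eq_sum_Icc, ← add_sum_Ioc_eq_sum_Icc hn] at h
  push_cast at h
  have e : Icc 2 n = Ioc 1 n := by ext; simp [Nat.succ_le_iff]
  simp only [one_div, e]
  linarith

theorem cube_le_sum_sq {f : ℕ} (hf : 2 ≤ f) : f ^ 3 ≤ 4 * ∑ k ∈ Icc 2 f, k ^ 2 := by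
  induction f, hf using Nat.le_induction with
  | base => decide
  | succ f hf ih =>
    rw [sum_Icc_succ_top (by omega)]
    nlinarith

/-- The collinear triple bound for `A × A`. -/
theorem sum_card_linePoints_cube_le (A : Finset ℝ) (Λ : Finset (ℝ × ℝ))
    (h0 : ∀ l ∈ Λ, l.1 ≠ 0) (hΛ : ∀ l ∈ Λ, 2 ≤ #(linePoints A l)) :
    ∑ l ∈ Λ, (#(linePoints A l) : ℝ) ^ 3 ≤ 400 * (#A : ℝ) ^ 4 * Real.log #A := by
  rcases Nat.eq_zero_or_pos #A with hA | hA
  · have : Λ = ∅ := eq_empty_of_forall_notMem fun l hl => by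
      have := hΛ l hl
      have := card_linePoints_le_card A l
      omega
    simp [this, hA]
  calc ∑ l ∈ Λ, (#(linePoints A l) : ℝ) ^ 3
      ≤ ∑ l ∈ Λ, ∑ k ∈ Icc 2 #A, if k ≤ #(linePoints A l) then 4 * (k : ℝ) ^ 2 else 0 := by
        refine sum_le_sum fun l hl => ?_
        have h1 : (#(linePoints A l) : ℝ) ^ 3 ≤
            4 * ∑ k ∈ Icc 2 #(linePoints A l), (k : ℝ) ^ 2 := by
          exact_mod_cast cube_le_sum_sq (hΛ l hl)
        refine h1.trans (le_of_eq ?_)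
        rw [mul_sum, ← sum_filter]
        refine sum_congr ?_ fun _ _ => rfl
        ext k
        have := card_linePoints_le_card A l
        simp only [mem_filter, mem_Icc]
        omega
    _ = ∑ k ∈ Icc 2 #A, #{l ∈ Λ | k ≤ #(linePoints A l)} * (4 * (k : ℝ) ^ 2) := by
        rw [sum_comm]
        refine sum_congr rfl fun k _ => ?_
        rw [← sum_filter, sum_const, nsmul_eq_mul]
    _ ≤ ∑ k ∈ Icc 2 #A, 400 * (#A : ℝ) ^ 4 * (1 / k) := by
        refine sum_le_sum fun k hk => ?_
        rw [mem_Icc] at hk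
        have hk0 : (0 : ℝ) < k := by exact_mod_cast (by omega : 0 < k)
        have h := card_rich_lines_le A hk.1 {l ∈ Λ | k ≤ #(linePoints A l)}
          (fun l hl => h0 l (mem_filter.1 hl).1) (fun l hl => (mem_filter.1 hl).2) hk.2
        calc _ ≤ 100 * (#A : ℝ) ^ 4 / k ^ 3 * (4 * (k : ℝ) ^ 2) := by gcongr
          _ = _ := by
            field_simp
            ring
    _ ≤ 400 * (#A : ℝ) ^ 4 * Real.log #A := by
        rw [← mul_sum]
        exact mul_le_mul_of_nonneg_left (sum_Icc_two_inv_le_log hA) (by positivity)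

/-- The pairs in `A × B` with distinct entries. -/
noncomputable def distinctPairs (A B : Finset ℝ) : Finset (ℝ × ℝ) :=
  (A ×ˢ B).filter fun z => z.1 ≠ z.2

/-- The ratio of the differences of two pairs. -/
noncomputable def diffRatio (t : (ℝ × ℝ) × (ℝ × ℝ)) : ℝ :=
  (t.1.1 - t.1.2) / (t.2.1 - t.2.2)

/-- The number of coincidences among ratios of nonzero elements of `A - B`. -/
noncomputable def ratioEnergy (A B : Finset ℝ) : ℕ :=
  #{z ∈ (distinctPairs A B ×ˢ distinctPairs A B) ×ˢ (distinctPairs A B ×ˢ distinctPairs A B) |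
    diffRatio z.1 = diffRatio z.2}

/-- The line of slope parameter `diffRatio t` through `(t.1.1, t.2.1)` and `(t.1.2, t.2.2)`. -/
noncomputable def ratioLine (t : (ℝ × ℝ) × (ℝ × ℝ)) : ℝ × ℝ :=
  (diffRatio t, t.1.1 - diffRatio t * t.2.1)

theorem mem_distinctPairs {A B : Finset ℝ} {z : ℝ × ℝ} :
    z ∈ distinctPairs A B ↔ (z.1 ∈ A ∧ z.2 ∈ B) ∧ z.1 ≠ z.2 := by
  simp [distinctPairs]

theorem ratioLine_snd {t : (ℝ × ℝ) × (ℝ × ℝ)} (ht : t.2.1 ≠ t.2.2) :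
    (ratioLine t).2 = t.1.2 - diffRatio t * t.2.2 := by
  have : t.2.1 - t.2.2 ≠ 0 := sub_ne_zero.2 ht
  have h : diffRatio t * (t.2.1 - t.2.2) = t.1.1 - t.1.2 := div_mul_cancel₀ _ this
  simp only [ratioLine]
  linarith

theorem fst_mem_linePoints {A B : Finset ℝ} {t : (ℝ × ℝ) × (ℝ × ℝ)}
    (ht : t ∈ distinctPairs A B ×ˢ distinctPairs A B) :
    (t.1.1, t.2.1) ∈ linePoints A (ratioLine t) := by
  simp only [mem_product, mem_distinctPairs] at ht
  exact mem_linePoints.2 ⟨⟨ht.1.1.1, ht.2.1.1⟩, rfl⟩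

theorem snd_mem_linePoints {A B : Finset ℝ} {t : (ℝ × ℝ) × (ℝ × ℝ)}
    (ht : t ∈ distinctPairs A B ×ˢ distinctPairs A B) :
    (t.1.2, t.2.2) ∈ linePoints B (ratioLine t) := by
  simp only [mem_product, mem_distinctPairs] at ht
  exact mem_linePoints.2 ⟨⟨ht.1.1.2, ht.2.1.2⟩, (ratioLine_snd ht.2.2).symm⟩

theorem card_ratioLine_fiber_le (A B : Finset ℝ) (l : ℝ × ℝ) :
    #{t ∈ distinctPairs A B ×ˢ distinctPairs A B | ratioLine t = l} ≤
      #(linePoints A l) * #(linePoints B l) := by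
  rw [← card_product]
  refine card_le_card_of_injOn (fun t => ((t.1.1, t.2.1), (t.1.2, t.2.2))) ?_ ?_
  · intro t ht
    obtain ⟨hQ, rfl⟩ := mem_filter.1 (mem_coe.1 ht)
    exact mem_coe.2 (mem_product.2 ⟨fst_mem_linePoints hQ, snd_mem_linePoints hQ⟩)
  · intro t _ t' _ h
    simp only [Prod.mk.injEq] at h
    ext <;> simp [h]

theorem card_filter_poorer_le (A B : Finset ℝ) (r : ℝ) (N : ℕ) :
    #{t ∈ distinctPairs A B ×ˢ distinctPairs A B |
      diffRatio t = r ∧ #(linePoints A (ratioLine t)) ≤ N} ≤ N * #B ^ 2 := by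
  rw [sq, ← card_product B B]
  refine card_le_mul_card_image_of_maps_to (f := fun t => (t.1.2, t.2.2)) ?_ _ ?_
  · intro t ht
    have ht := (mem_filter.1 ht).1
    simp only [mem_product, mem_distinctPairs] at ht ⊢
    exact ⟨ht.1.1.2, ht.2.1.2⟩
  · intro b _
    rw [filter_filter]
    rcases eq_empty_or_nonempty {t ∈ distinctPairs A B ×ˢ distinctPairs A B |
      (diffRatio t = r ∧ #(linePoints A (ratioLine t)) ≤ N) ∧ (t.1.2, t.2.2) = b} with h | ⟨s, hs⟩
    · simp [h]
    obtain ⟨hs, ⟨hsr, hsN⟩, hsb⟩ := mem_filter.1 hs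
    refine le_trans (card_le_card_of_injOn (fun t => (t.1.1, t.2.1)) ?_ ?_) hsN
    · intro t ht
      obtain ⟨ht, ⟨htr, -⟩, htb⟩ := mem_filter.1 (mem_coe.1 ht)
      have e : ratioLine t = ratioLine s := by
        refine Prod.ext (htr.trans hsr.symm) ?_
        rw [ratioLine_snd (mem_distinctPairs.1 (mem_product.1 ht).2).2,
          ratioLine_snd (mem_distinctPairs.1 (mem_product.1 hs).2).2, htr, hsr]
        have := htb.trans hsb.symm
        simp only [Prod.mk.injEq] at this
        rw [this.1, this.2]
      rw [← e]
      exact mem_coe.2 (fst_mem_linePoints ht)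
    · intro t ht t' ht' h
      have e := (mem_filter.1 (mem_coe.1 ht)).2.2
      have e' := (mem_filter.1 (mem_coe.1 ht')).2.2
      have e2 := e.trans e'.symm
      simp only [Prod.mk.injEq] at h e2
      ext <;> simp [h, e2]

theorem ratioEnergy_le_sum (A B : Finset ℝ) :
    ratioEnergy A B ≤ 2 * (#B ^ 2 * ∑ t ∈ distinctPairs A B ×ˢ distinctPairs A B,
      #(linePoints A (ratioLine t))) := by
  set Q := distinctPairs A B ×ˢ distinctPairs A B with hQ
  set F := fun t => #(linePoints A (ratioLine t)) with hF
  have h1 : #{z ∈ Q ×ˢ Q | diffRatio z.1 = diffRatio z.2 ∧ F z.1 ≤ F z.2} ≤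
      #B ^ 2 * ∑ t ∈ Q, F t := by
    rw [card_eq_sum_card_fiberwise (f := Prod.snd) (t := Q)
      fun z hz => (mem_product.1 (mem_filter.1 (mem_coe.1 hz)).1).2, mul_sum]
    refine sum_le_sum fun s _ => ?_
    rw [mul_comm]
    refine le_trans (card_le_card_of_injOn Prod.fst ?_ ?_)
      (card_filter_poorer_le A B (diffRatio s) (F s))
    · intro z hz
      simp only [coe_filter, mem_filter, mem_product] at hz
      obtain ⟨⟨hz, h⟩, rfl⟩ := hz
      simpa only [mem_coe, mem_filter, mem_product] using ⟨mem_product.1 hz.1, h⟩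
    · intro z hz z' hz' h
      exact Prod.ext h ((mem_filter.1 (mem_coe.1 hz)).2.trans
        (mem_filter.1 (mem_coe.1 hz')).2.symm)
  have h2 : #{z ∈ Q ×ˢ Q | diffRatio z.1 = diffRatio z.2 ∧ F z.2 ≤ F z.1} ≤
      #{z ∈ Q ×ˢ Q | diffRatio z.1 = diffRatio z.2 ∧ F z.1 ≤ F z.2} := by
    refine card_le_card_of_injOn Prod.swap (fun z hz => ?_) Prod.swap_injective.injOn
    obtain ⟨hz, hr, hz'⟩ := mem_filter.1 (mem_coe.1 hz)
    exact mem_coe.2 (mem_filter.2 ⟨mem_product.2 (mem_product.1 hz).symm, hr.symm, hz'⟩)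
  have h3 : ratioEnergy A B ≤ #{z ∈ Q ×ˢ Q | diffRatio z.1 = diffRatio z.2 ∧ F z.1 ≤ F z.2} +
      #{z ∈ Q ×ˢ Q | diffRatio z.1 = diffRatio z.2 ∧ F z.2 ≤ F z.1} := by
    refine le_trans (card_le_card fun z hz => ?_) (card_union_le _ _)
    obtain ⟨hz, hr⟩ := mem_filter.1 hz
    simp only [mem_union, mem_filter]
    exact (le_total (F z.1) (F z.2)).imp (fun h => ⟨hz, hr, h⟩) fun h => ⟨hz, hr, h⟩
  have h4 : ratioEnergy A B ≤ 2 * (#B ^ 2 * ∑ t ∈ Q, F t) := by omega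
  exact h4

theorem le_add_ite_add_ite {x φ γ : ℝ} (hx : 1 ≤ x) (hφ : φ = 1 ∨ 2 ≤ φ) (hγ : γ = 1 ∨ 2 ≤ γ) :
    φ ≤ x + (if 2 ≤ φ then x⁻¹ * (φ ^ 2 / γ) else 0) +
      if 2 ≤ γ then x ^ 2 * (γ ^ 2 / φ) else 0 := by
  have hx0 : 0 < x := by linarith
  have hφ0 : 0 < φ := by rcases hφ with h | h <;> linarith
  have hγ0 : 0 < γ := by rcases hγ with h | h <;> linarith
  have p1 : 0 ≤ if 2 ≤ φ then x⁻¹ * (φ ^ 2 / γ) else 0 := by split_ifs <;> positivity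
  have p2 : 0 ≤ if 2 ≤ γ then x ^ 2 * (γ ^ 2 / φ) else 0 := by split_ifs <;> positivity
  rcases le_total (x * γ) φ with h | h
  · rcases hφ with h1 | h1
    · linarith
    · rw [if_pos h1] at p1 ⊢
      have : φ ≤ x⁻¹ * (φ ^ 2 / γ) := by
        rw [inv_mul_eq_div, div_div, le_div_iff₀ (by positivity)]
        nlinarith
      linarith
  · rcases hγ with h1 | h1
    · rw [h1, mul_one] at h
      linarith
    · rw [if_pos h1] at p2 ⊢
      have : φ ≤ x ^ 2 * (γ ^ 2 / φ) := by
        rw [← mul_div_assoc, le_div_iff₀ hφ0]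
        nlinarith
      linarith

theorem sum_ite_div_le (A B A' B' : Finset ℝ)
    (hfib : ∀ l, #{t ∈ distinctPairs A B ×ˢ distinctPairs A B | ratioLine t = l} ≤
      #(linePoints A' l) * #(linePoints B' l)) :
    ∑ t ∈ distinctPairs A B ×ˢ distinctPairs A B,
      (if (2 : ℝ) ≤ #(linePoints A' (ratioLine t)) then
        (#(linePoints A' (ratioLine t)) : ℝ) ^ 2 / #(linePoints B' (ratioLine t)) else 0) ≤
      400 * (#A' : ℝ) ^ 4 * Real.log #A' := by
  set Q := distinctPairs A B ×ˢ distinctPairs A B with hQ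
  set g : ℝ × ℝ → ℝ := fun l => if (2 : ℝ) ≤ #(linePoints A' l) then
        (#(linePoints A' l) : ℝ) ^ 2 / #(linePoints B' l) else 0 with hg
  have hg0 : ∀ l, 0 ≤ g l := fun l => by
    simp only [hg]
    split_ifs <;> positivity
  calc ∑ t ∈ Q, g (ratioLine t)
      = ∑ l ∈ Q.image ratioLine, #{t ∈ Q | ratioLine t = l} * g l := by
        rw [sum_comp]
        simp
    _ ≤ ∑ l ∈ Q.image ratioLine, if (2 : ℝ) ≤ #(linePoints A' l) then
          (#(linePoints A' l) : ℝ) ^ 3 else 0 := by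
        refine sum_le_sum fun l _ => ?_
        have h : (#{t ∈ Q | ratioLine t = l} : ℝ) ≤
            #(linePoints A' l) * #(linePoints B' l) := by exact_mod_cast hfib l
        refine (mul_le_mul_of_nonneg_right h (hg0 l)).trans ?_
        simp only [hg]
        split_ifs
        · rcases eq_or_ne (#(linePoints B' l) : ℝ) 0 with h0 | h0
          · rw [h0]
            simp only [mul_zero, zero_mul]
            positivity
          · apply le_of_eq
            field_simp
        · simp
    _ ≤ _ := by
        rw [← sum_filter]
        refine sum_card_linePoints_cube_le A' _ (fun l hl => ?_) fun l hl => ?_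
        · obtain ⟨t, ht, rfl⟩ := mem_image.1 (mem_filter.1 hl).1
          simp only [hQ, mem_product, mem_distinctPairs] at ht
          exact div_ne_zero (sub_ne_zero.2 ht.1.2) (sub_ne_zero.2 ht.2.2)
        · exact_mod_cast (mem_filter.1 hl).2

theorem one_le_log_add_log {n m : ℕ} (hn : 2 ≤ n) (hm : 2 ≤ m) :
    1 ≤ Real.log n + Real.log m := by
  have h : ∀ k : ℕ, 2 ≤ k → Real.log 2 ≤ Real.log k := fun k hk =>
    Real.log_le_log two_pos (by exact_mod_cast hk)
  linarith [h n hn, h m hm, Real.log_two_gt_d9]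

theorem ratioEnergy_le_of_card_le {A B : Finset ℝ} (hA : 2 ≤ #A) (hB : 2 ≤ #B)
    (hBA : #B ≤ #A) :
    (ratioEnergy A B : ℝ) ≤
      802 * ((#A : ℝ) ^ 3 * (#B : ℝ) ^ 3 * (Real.log #A + Real.log #B)) := by
  set Q := distinctPairs A B ×ˢ distinctPairs A B with hQ
  have hn : (0 : ℝ) < #A := by exact_mod_cast (by omega : 0 < #A)
  have hm : (0 : ℝ) < #B := by exact_mod_cast (by omega : 0 < #B)
  have hmn : (#B : ℝ) ≤ #A := by exact_mod_cast hBA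
  have hL := one_le_log_add_log hA hB
  have hlA : 0 ≤ Real.log #A := Real.log_natCast_nonneg _
  have hlB : 0 ≤ Real.log #B := Real.log_natCast_nonneg _
  set n : ℝ := (#A : ℝ) with hn'
  set m : ℝ := (#B : ℝ) with hm'
  have hx : 1 ≤ n / m := (one_le_div hm).2 hmn
  have one_or_two : ∀ k : ℕ, 0 < k → (k : ℝ) = 1 ∨ (2 : ℝ) ≤ k := fun k hk => by
    rcases (by omega : k = 1 ∨ 2 ≤ k) with h | h
    · exact Or.inl (by exact_mod_cast h)
    · exact Or.inr (by exact_mod_cast h)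
  have hQcard : (#Q : ℝ) ≤ (n * m) ^ 2 := by
    have h1 : #(distinctPairs A B) ≤ #A * #B := by
      rw [← card_product]
      exact card_filter_le _ _
    have h2 : #Q ≤ (#A * #B) ^ 2 := by
      rw [hQ, card_product, sq]
      exact Nat.mul_le_mul h1 h1
    rw [hn', hm']
    exact_mod_cast h2
  have hsum : ∑ t ∈ Q, (#(linePoints A (ratioLine t)) : ℝ) ≤
      (n * m) ^ 2 * (n / m) + (n / m)⁻¹ * (400 * n ^ 4 * Real.log n) +
        (n / m) ^ 2 * (400 * m ^ 4 * Real.log m) := by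
    have h1 := sum_ite_div_le A B A B (card_ratioLine_fiber_le A B)
    have h2 := sum_ite_div_le A B B A fun l => by
      rw [mul_comm]
      exact card_ratioLine_fiber_le A B l
    calc _ ≤ ∑ t ∈ Q, (n / m + (n / m)⁻¹ * (if (2 : ℝ) ≤ #(linePoints A (ratioLine t)) then
          (#(linePoints A (ratioLine t)) : ℝ) ^ 2 / #(linePoints B (ratioLine t)) else 0) +
          (n / m) ^ 2 * (if (2 : ℝ) ≤ #(linePoints B (ratioLine t)) then
          (#(linePoints B (ratioLine t)) : ℝ) ^ 2 / #(linePoints A (ratioLine t)) else 0)) := by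
          refine sum_le_sum fun t ht => ?_
          simp only [mul_ite, mul_zero]
          exact le_add_ite_add_ite hx
            (one_or_two _ (card_pos.2 ⟨_, fst_mem_linePoints ht⟩))
            (one_or_two _ (card_pos.2 ⟨_, snd_mem_linePoints ht⟩))
      _ ≤ _ := by
          rw [sum_add_distrib, sum_add_distrib, ← mul_sum, ← mul_sum, sum_const, nsmul_eq_mul]
          gcongr
  have hE : (ratioEnergy A B : ℝ) ≤
      2 * (m ^ 2 * ∑ t ∈ Q, (#(linePoints A (ratioLine t)) : ℝ)) := by
    rw [hm']
    exact_mod_cast ratioEnergy_le_sum A B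
  have e1 : (n * m) ^ 2 * (n / m) = n ^ 3 * m := by field_simp
  have e2 : (n / m)⁻¹ * (400 * n ^ 4 * Real.log n) = 400 * (n ^ 3 * m) * Real.log n := by
    field_simp
  have e3 : (n / m) ^ 2 * (400 * m ^ 4 * Real.log m) ≤ 400 * (n ^ 3 * m) * Real.log m := by
    have : (n / m) ^ 2 * (400 * m ^ 4 * Real.log m) = 400 * (n ^ 2 * m * m) * Real.log m := by
      field_simp
    rw [this]
    have h : n ^ 2 * m * m ≤ n ^ 2 * m * n := by gcongr
    have h' : n ^ 2 * m * n = n ^ 3 * m := by ring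
    rw [h'] at h
    gcongr
  have e4 : n ^ 3 * m ≤ n ^ 3 * m * (Real.log n + Real.log m) :=
    le_mul_of_one_le_right (by positivity) hL
  have hS : ∑ t ∈ Q, (#(linePoints A (ratioLine t)) : ℝ) ≤
      401 * (n ^ 3 * m * (Real.log n + Real.log m)) := by
    rw [e1, e2] at hsum
    linarith
  calc _ ≤ 2 * (m ^ 2 * (401 * (n ^ 3 * m * (Real.log n + Real.log m)))) := by
        refine hE.trans ?_
        gcongr
    _ = _ := by ring

theorem ratioEnergy_comm_le (A B : Finset ℝ) : ratioEnergy A B ≤ ratioEnergy B A := by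
  refine card_le_card_of_injOn
    (fun z => ((z.1.1.swap, z.1.2.swap), (z.2.1.swap, z.2.2.swap))) ?_ ?_
  · intro z hz
    have key : ∀ t : (ℝ × ℝ) × (ℝ × ℝ), diffRatio (t.1.swap, t.2.swap) = diffRatio t := fun t => by
      simp only [diffRatio, Prod.fst_swap, Prod.snd_swap]
      rw [← neg_sub t.1.1, ← neg_sub t.2.1, neg_div_neg_eq]
    obtain ⟨hz, hr⟩ := mem_filter.1 (mem_coe.1 hz)
    refine mem_coe.2 (mem_filter.2 ⟨?_, ?_⟩)
    · simp only [mem_product, mem_distinctPairs, Prod.fst_swap, Prod.snd_swap] at hz ⊢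
      grind
    · rw [key, key, hr]
  · intro z _ z' _ h
    simp only [Prod.mk.injEq, Prod.swap_inj] at h
    ext <;> simp [h]

theorem ratioEnergy_le {A B : Finset ℝ} (hA : 2 ≤ #A) (hB : 2 ≤ #B) :
    (ratioEnergy A B : ℝ) ≤
      802 * ((#A : ℝ) ^ 3 * (#B : ℝ) ^ 3 * (Real.log #A + Real.log #B)) := by
  rcases le_total #B #A with h | h
  · exact ratioEnergy_le_of_card_le hA hB h
  · have h1 : (ratioEnergy A B : ℝ) ≤ ratioEnergy B A := by
      exact_mod_cast ratioEnergy_comm_le A B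
    refine h1.trans ((ratioEnergy_le_of_card_le hB hA h).trans (le_of_eq ?_))
    ring

theorem two_mul_card_filter_eq_le {α β γ : Type*} [DecidableEq γ] (S : Finset α) (T : Finset β)
    (f : α → γ) (g : β → γ) :
    2 * #{z ∈ S ×ˢ T | f z.1 = g z.2} ≤
      #{z ∈ S ×ˢ S | f z.1 = f z.2} + #{z ∈ T ×ˢ T | g z.1 = g z.2} := by
  have hf : ∀ a ∈ S, f a ∈ S.image f ∪ T.image g := fun a ha =>
    mem_union_left _ (mem_image_of_mem f ha)
  have hg : ∀ b ∈ T, g b ∈ S.image f ∪ T.image g := fun b hb =>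
    mem_union_right _ (mem_image_of_mem g hb)
  rw [card_filter_product_eq_sum S T f g _ hf, card_filter_product_eq_sum S S f f _ hf,
    card_filter_product_eq_sum T T g g _ hg, mul_sum, ← sum_add_distrib]
  refine sum_le_sum fun r _ => ?_
  have := two_mul_le_add_sq #{a ∈ S | f a = r} #{b ∈ T | g b = r}
  rw [sq, sq] at this
  rwa [← mul_assoc]

theorem card_sq_le_card_image_mul {α γ : Type*} [DecidableEq γ] (S : Finset α) (f : α → γ) :
    #S ^ 2 ≤ #(S.image f) * #{z ∈ S ×ˢ S | f z.1 = f z.2} := by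
  rw [card_filter_product_eq_sum S S f f (S.image f) fun a ha => mem_image_of_mem f ha]
  nth_rw 1 [card_eq_sum_card_image f S]
  simp only [← sq]
  exact sq_sum_le_card_mul_sum_sq

theorem card_mul_card_le_two_mul_card_distinctPairs {A B : Finset ℝ} (hB : 2 ≤ #B) :
    #A * #B ≤ 2 * #(distinctPairs A B) := by
  have h1 : #{z ∈ A ×ˢ B | ¬ z.1 ≠ z.2} ≤ #A := by
    refine card_le_card_of_injOn Prod.fst (fun z hz => ?_) fun z hz z' hz' h => ?_
    · exact (mem_product.1 (mem_filter.1 (mem_coe.1 hz)).1).1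
    · have e := not_not.1 (mem_filter.1 (mem_coe.1 hz)).2
      have e' := not_not.1 (mem_filter.1 (mem_coe.1 hz')).2
      exact Prod.ext h (by rw [← e, ← e', h])
  have h2 := card_filter_add_card_filter_not (s := A ×ˢ B) (fun z => z.1 ≠ z.2)
  rw [card_product] at h2
  have h3 : #A * 2 ≤ #A * #B := Nat.mul_le_mul_left _ hB
  have h4 : #(distinctPairs A B) = #{z ∈ A ×ˢ B | z.1 ≠ z.2} := rfl
  omega

theorem two_mul_card_product_coincidences_le (A B C D : Finset ℝ) :
    2 * #{w ∈ (distinctPairs A B ×ˢ distinctPairs C D) ×ˢ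
        (distinctPairs A B ×ˢ distinctPairs C D) |
      (w.1.1.1 - w.1.1.2) * (w.1.2.1 - w.1.2.2) = (w.2.1.1 - w.2.1.2) * (w.2.2.1 - w.2.2.2)} ≤
      ratioEnergy A B + ratioEnergy C D := by
  refine le_trans (Nat.mul_le_mul_left 2 ?_) (two_mul_card_filter_eq_le
    (distinctPairs A B ×ˢ distinctPairs A B) (distinctPairs C D ×ˢ distinctPairs C D)
    diffRatio diffRatio)
  refine card_le_card_of_injOn (fun w => ((w.1.1, w.2.1), (w.2.2, w.1.2))) ?_ ?_
  · intro w hw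
    obtain ⟨hw, h⟩ := mem_filter.1 (mem_coe.1 hw)
    simp only [mem_product] at hw
    refine mem_coe.2 (mem_filter.2 ⟨by simp only [mem_product]; tauto, ?_⟩)
    have h1 := sub_ne_zero.2 (mem_distinctPairs.1 hw.2.1).2
    have h2 := sub_ne_zero.2 (mem_distinctPairs.1 hw.1.2).2
    simp only [diffRatio]
    rw [div_eq_div_iff h1 h2, h, mul_comm]
  · intro w _ w' _ h
    simp only [Prod.mk.injEq] at h
    ext <;> simp [h]

theorem card_mul_card_le_card_sub_mul_sub {A B C D : Finset ℝ} (hA : 2 ≤ #A) (hB : 2 ≤ #B)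
    (hC : #C = #A) (hD : #D = #B) :
    (#A * #B : ℝ) ≤
      12832 * #((A - B) * (C - D)) * (Real.log #A + Real.log #B) := by
  set S := distinctPairs A B ×ˢ distinctPairs C D with hS
  set f : (ℝ × ℝ) × (ℝ × ℝ) → ℝ := fun s => (s.1.1 - s.1.2) * (s.2.1 - s.2.2) with hf
  have himg : #(S.image f) ≤ #((A - B) * (C - D)) := by
    refine card_le_card (image_subset_iff.2 fun s hs => ?_)
    simp only [hS, mem_product, mem_distinctPairs] at hs
    exact mul_mem_mul (sub_mem_sub hs.1.1.1 hs.1.1.2) (sub_mem_sub hs.2.1.1 hs.2.1.2)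
  have h1 : (#A * #B) ^ 2 ≤ 4 * #S := by
    have h1 := card_mul_card_le_two_mul_card_distinctPairs (A := A) hB
    have h2 := card_mul_card_le_two_mul_card_distinctPairs (A := C) (B := D) (hD ▸ hB)
    rw [hC, hD] at h2
    rw [hS, card_product]
    calc (#A * #B) ^ 2 = (#A * #B) * (#A * #B) := sq _
      _ ≤ (2 * #(distinctPairs A B)) * (2 * #(distinctPairs C D)) := Nat.mul_le_mul h1 h2
      _ = _ := by ring
  have h2 := card_sq_le_card_image_mul S f
  have h3 := two_mul_card_product_coincidences_le A B C D
  have h4 := ratioEnergy_le hA hB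
  have h5 := ratioEnergy_le (A := C) (B := D) (hC ▸ hA) (hD ▸ hB)
  rw [hC, hD] at h5
  have hn : (0 : ℝ) < #A := by exact_mod_cast (by omega : 0 < #A)
  have hm : (0 : ℝ) < #B := by exact_mod_cast (by omega : 0 < #B)
  have h6 : (#{z ∈ S ×ˢ S | f z.1 = f z.2} : ℝ) ≤
      802 * ((#A : ℝ) ^ 3 * (#B : ℝ) ^ 3 * (Real.log #A + Real.log #B)) := by
    have h3' : (2 : ℝ) * #{z ∈ S ×ˢ S | f z.1 = f z.2} ≤
      ratioEnergy A B + ratioEnergy C D := by exact_mod_cast h3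
    linarith
  have h7 : ((#A * #B : ℝ) ^ 2) ^ 2 ≤ (4 * #S) ^ 2 := by
    have : (#A * #B : ℝ) ^ 2 ≤ 4 * #S := by exact_mod_cast h1
    gcongr
  have h8 : (#S : ℝ) ^ 2 ≤ #((A - B) * (C - D)) *
      (802 * ((#A : ℝ) ^ 3 * (#B : ℝ) ^ 3 * (Real.log #A + Real.log #B))) := by
    have h2' : (#S : ℝ) ^ 2 ≤ #(S.image f) * #{z ∈ S ×ˢ S | f z.1 = f z.2} := by
      exact_mod_cast h2
    refine h2'.trans ?_
    gcongr
  have hpos : 0 < ((#A : ℝ) * #B) ^ 3 := by positivity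
  refine le_of_mul_le_mul_right ?_ hpos
  calc (#A * #B : ℝ) * (#A * #B) ^ 3 = ((#A * #B : ℝ) ^ 2) ^ 2 := by ring
    _ ≤ 16 * (#S : ℝ) ^ 2 := by linarith [h7]
    _ ≤ 16 * (#((A - B) * (C - D)) *
      (802 * ((#A : ℝ) ^ 3 * (#B : ℝ) ^ 3 * (Real.log #A + Real.log #B)))) := by gcongr
    _ = _ := by ring

end

/-- There is an absolute constant c > 0 such that for all finite
sets A, B ⊆ ℝ with |A| ≥ 2 and |B| ≥ 2, one has
|(A + B)·(A - B)| ≥ c·|A||B|/(log|A| + log|B|). -/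
theorem sum_product_estimate_4 :
    ∃ c : ℝ, 0 < c ∧
      ∀ A B : Finset ℝ, 2 ≤ A.card → 2 ≤ B.card →
        (((A + B) * (A - B)).card : ℝ) ≥
          c * A.card * B.card / (Real.log A.card + Real.log B.card) := by
  refine ⟨1 / 12832, by norm_num, fun A B hA hB => ?_⟩
  have hL := one_le_log_add_log hA hB
  have h := card_mul_card_le_card_sub_mul_sub (B := -B) (C := A) (D := B) hA
    (by rwa [Finset.card_neg]) rfl (Finset.card_neg B).symm
  rw [sub_neg_eq_add, Finset.card_neg] at h
  rw [ge_iff_le, div_le_iff₀ (by linarith)]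
  linarith
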